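/- Let γ be a cointegral on C and g ∈ C a grouplike element. Define Q := { q ∈ C | for all c ∈ C, q * c = γ(g ⊗ c) • q }. Then Q is a left ideal for the cointegral product: for all c ∈ C and q ∈ Q, c * q ∈ Q. -/

import Mathlib

open TensorProduct

variable {A C : Type*} [CommRing A] [AddCommGroup C] [Module A C] [Coalgebra A C]

/-- The cointegral product as a linear map `C ⊗[A] C →ₗ[A] C`;
on simple tensors, `c ⊗ c' ↦ Σ γ(c ⊗ c'₍₁₎) • c'₍₂₎`. -/
noncomputable def cointMulL (γ : C ⊗[A] C →ₗ[A] A) : C ⊗[A] C →ₗ[A] C :=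
  (TensorProduct.lid A C).toLinearMap
    ∘ₗ LinearMap.rTensor C γ
    ∘ₗ (TensorProduct.assoc A C C C).symm.toLinearMap
    ∘ₗ LinearMap.lTensor C Coalgebra.comul

/-- The alternative expression of the cointegral product;
on simple tensors, `c ⊗ c' ↦ Σ γ(c₍₂₎ ⊗ c') • c₍₁₎`. -/
noncomputable def cointMulR (γ : C ⊗[A] C →ₗ[A] A) : C ⊗[A] C →ₗ[A] C :=
  (TensorProduct.rid A C).toLinearMap
    ∘ₗ LinearMap.lTensor C γ
    ∘ₗ (TensorProduct.assoc A C C C).toLinearMap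
    ∘ₗ LinearMap.rTensor C Coalgebra.comul

/-- `Q = { q ∈ C | ∀ c, q * c = γ(g ⊗ c) • q }`, where `*` denotes the
cointegral product. -/
noncomputable def Qset (γ : C ⊗[A] C →ₗ[A] A) (g : C) : Set C :=
  {q : C | ∀ c : C, cointMulL γ (q ⊗ₜ[A] c) = γ (g ⊗ₜ[A] c) • q}

/-- Contraction of the left leg of the comultiplication. -/
noncomputable def contrL (f : C →ₗ[A] A) : C ⊗[A] C →ₗ[A] C :=
  (TensorProduct.lid A C).toLinearMap ∘ₗ LinearMap.rTensor C f

/-- Contraction of the right leg of the comultiplication. -/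
noncomputable def contrR (h : C →ₗ[A] A) : C ⊗[A] C →ₗ[A] C :=
  (TensorProduct.rid A C).toLinearMap ∘ₗ LinearMap.lTensor C h

theorem cointMulL_eq (γ : C ⊗[A] C →ₗ[A] A) (c q : C) :
    cointMulL γ (c ⊗ₜ[A] q) =
      contrL (γ ∘ₗ TensorProduct.mk A C C c) (Coalgebra.comul q) := by
  simp only [cointMulL, contrL, LinearMap.comp_apply, LinearMap.lTensor_tmul]
  generalize (Coalgebra.comul q : C ⊗[A] C) = t
  induction t with
  | zero => simp
  | tmul x y => simp
  | add x y hx hy => simp only [TensorProduct.tmul_add, map_add, hx, hy]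

theorem cointMulR_eq (γ : C ⊗[A] C →ₗ[A] A) (q d : C) :
    cointMulR γ (q ⊗ₜ[A] d) =
      contrR (γ ∘ₗ (TensorProduct.mk A C C).flip d) (Coalgebra.comul q) := by
  simp only [cointMulR, contrR, LinearMap.comp_apply, LinearMap.rTensor_tmul]
  generalize (Coalgebra.comul q : C ⊗[A] C) = t
  induction t with
  | zero => simp
  | tmul x y => simp
  | add x y hx hy => simp only [TensorProduct.add_tmul, map_add, hx, hy]

theorem contrR_contrL (f h : C →ₗ[A] A) (t : C ⊗[A] C) :
    contrR h (Coalgebra.comul (contrL f t)) =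
      contrL f (LinearMap.lTensor C (contrR h) (LinearMap.lTensor C Coalgebra.comul t)) := by
  induction t with
  | zero => simp
  | tmul x y => simp [contrL]
  | add x y hx hy => simp only [map_add, hx, hy]

theorem contrL_contrR (f h : C →ₗ[A] A) (t : C ⊗[A] C) :
    contrL f (Coalgebra.comul (contrR h t)) =
      contrL f (LinearMap.lTensor C (contrR h)
        (TensorProduct.assoc A C C C (LinearMap.rTensor C Coalgebra.comul t))) := by
  induction t with
  | zero => simp
  | tmul x y =>
    simp only [contrR, LinearMap.comp_apply, LinearMap.lTensor_tmul, LinearMap.rTensor_tmul,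
      LinearEquiv.coe_coe, TensorProduct.rid_tmul, map_smul]
    generalize (Coalgebra.comul x : C ⊗[A] C) = s
    induction s with
    | zero => simp
    | tmul u v => simp [contrL, smul_smul, mul_comm]
    | add u v hu hv => simp only [map_add, smul_add, TensorProduct.add_tmul, hu, hv]
  | add x y hx hy => simp only [map_add, hx, hy]

/-- `Q` is a left ideal for the cointegral product. -/
theorem Qset_left_ideal (γ : C ⊗[A] C →ₗ[A] A)
    (hcol : ∀ c c' : C, cointMulL γ (c ⊗ₜ[A] c') = cointMulR γ (c ⊗ₜ[A] c'))
    (hnorm : ∀ c : C, γ (Coalgebra.comul c) = Coalgebra.counit c)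
    (g : C) (hg : Coalgebra.comul g = g ⊗ₜ[A] g) (hg' : Coalgebra.counit g = (1 : A)) :
    ∀ (c : C) (q : C), q ∈ Qset γ g → cointMulL γ (c ⊗ₜ[A] q) ∈ Qset γ g := by
  intro c q hq d
  have hqd := hq d
  have key : cointMulL γ (cointMulL γ (c ⊗ₜ[A] q) ⊗ₜ[A] d) =
      cointMulL γ (c ⊗ₜ[A] cointMulL γ (q ⊗ₜ[A] d)) := by
    rw [hcol _ d, hcol q d, cointMulR_eq, cointMulR_eq, cointMulL_eq, cointMulL_eq,
      contrR_contrL, contrL_contrR, Coalgebra.coassoc_apply]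
  rw [key, hqd, TensorProduct.tmul_smul, map_smul]
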